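/- arXiv:2202.10815 — 2 statements merged into one kernel-verified Lean document; each statement's English description precedes it below -/
import Mathlib

section
/- Let d, x, y be nonnegative integers with x + y ≤ d and d ≥ 1. Then binom(d−y, x) ≤ e^{−xy/d} · binom(d, x). -/
/-- Shrinking the upper index by one costs a factor of at most `e^{-x/d}` when it is at most `d`. -/
theorem choose_le_exp_mul_choose_succ {d n x : ℕ} (hn : n + 1 ≤ d) (hx : x ≤ n + 1) :
    (n.choose x : ℝ) ≤ Real.exp (-(x / d : ℝ)) * ((n + 1).choose x : ℝ) := by
  have hrec : (n.choose x : ℝ) * (n + 1) = (n + 1).choose x * (n + 1 - x) := by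
    have h := congrArg (Nat.cast (R := ℝ)) (Nat.choose_mul_succ_eq n x)
    rw [Nat.cast_mul, Nat.cast_mul, Nat.cast_sub hx] at h
    push_cast at h
    exact h
  have hpos : (0 : ℝ) < n + 1 := by positivity
  have hnd : (n + 1 : ℝ) ≤ d := by exact_mod_cast hn
  have hdiv : (x / d : ℝ) ≤ x / (n + 1) := by gcongr
  calc (n.choose x : ℝ) = (1 - x / (n + 1)) * (n + 1).choose x := by
        field_simp
        linarith
    _ ≤ Real.exp (-(x / d : ℝ)) * (n + 1).choose x := by
        gcongr
        linarith [Real.one_sub_le_exp_neg (x / d : ℝ)]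

/-- For nonnegative integers `x, y` with `x + y ≤ d` and `d ≥ 1`:
`C(d-y, x) ≤ e^{-xy/d} · C(d, x)`. -/
theorem choose_sub_le_exp_mul_choose (d x y : ℕ) (hd : 1 ≤ d) (hxy : x + y ≤ d) :
    (((d - y).choose x : ℝ)) ≤ Real.exp (-((x : ℝ) * y) / d) * (d.choose x : ℝ) := by
  induction y with
  | zero => simp
  | succ y ih =>
    have hsucc : d - (y + 1) + 1 = d - y := by omega
    have hstep := choose_le_exp_mul_choose_succ (d := d) (n := d - (y + 1)) (x := x)
      (by omega) (by omega)
    rw [hsucc] at hstep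
    calc ((d - (y + 1)).choose x : ℝ)
        ≤ Real.exp (-(x / d : ℝ)) * (d - y).choose x := hstep
      _ ≤ Real.exp (-(x / d : ℝ)) * (Real.exp (-((x : ℝ) * y) / d) * d.choose x) := by
          gcongr
          exact ih (by omega)
      _ = Real.exp (-((x : ℝ) * (y + 1 : ℕ)) / d) * d.choose x := by
          rw [← mul_assoc, ← Real.exp_add]
          congr 2
          push_cast
          ring
end

section
/- Let d ≥ 1 and let d_1, …, d_n be nonnegative integers with d_1 + ⋯ + d_n = d. Then the multinomial coefficient satisfies d! / (d_1! ⋯ d_n!) ≤ exp( − (Σ_{1 ≤ j < i ≤ n} d_i d_j) / d ) · Π_{i=1}^n binom(d, d_i). -/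
/-- Lowering the upper index from `d` to `m` shrinks `C(d, k)` by at least `exp(-(d - m) k / d)`. -/
theorem choose_le_exp_mul_choose {m d : ℕ} (hd : 1 ≤ d) (hmd : m ≤ d) (k : ℕ) :
    (m.choose k : ℝ) ≤ Real.exp (-(((d : ℝ) - m) * k) / d) * (d.choose k : ℝ) := by
  have hd0 : (0 : ℝ) < d := by exact_mod_cast hd
  have hmd' : (m : ℝ) ≤ d := by exact_mod_cast hmd
  induction k with
  | zero => simp
  | succ k ih =>
    rcases lt_or_ge m (k + 1) with hk | hk
    · rw [Nat.choose_eq_zero_of_lt hk, Nat.cast_zero]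
      positivity
    have hkm : (k : ℝ) ≤ m := by exact_mod_cast (Nat.le_succ k).trans hk
    have succ_mul_choose (a : ℕ) (ha : k ≤ a) :
        (a.choose (k + 1) : ℝ) * (k + 1) = a.choose k * ((a : ℝ) - k) := by
      have h := Nat.choose_succ_right_eq a k
      rw [← Nat.cast_sub ha]
      exact_mod_cast h
    have hm := succ_mul_choose m (by omega)
    have hD := succ_mul_choose d (by omega)
    have factor_le : (m : ℝ) - k ≤ Real.exp (-((d : ℝ) - m) / d) * ((d : ℝ) - k) := by
      have hexp : (m : ℝ) / d ≤ Real.exp (-((d : ℝ) - m) / d) := by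
        refine le_trans (le_of_eq ?_) (Real.add_one_le_exp _)
        field_simp
        ring
      refine le_trans ?_ (mul_le_mul_of_nonneg_right hexp (by linarith))
      rw [div_mul_eq_mul_div, le_div_iff₀ hd0]
      nlinarith [mul_nonneg (Nat.cast_nonneg (α := ℝ) k) (sub_nonneg.2 hmd')]
    have exp_split : Real.exp (-(((d : ℝ) - m) * ((k + 1 : ℕ) : ℝ)) / d)
        = Real.exp (-(((d : ℝ) - m) * k) / d) * Real.exp (-((d : ℝ) - m) / d) := by
      rw [← Real.exp_add]
      congr 1
      push_cast
      ring
    refine le_of_mul_le_mul_right ?_ (by positivity : (0 : ℝ) < k + 1)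
    rw [hm, mul_assoc, hD, exp_split]
    calc (m.choose k : ℝ) * ((m : ℝ) - k)
        ≤ (Real.exp (-(((d : ℝ) - m) * k) / d) * d.choose k)
            * (Real.exp (-((d : ℝ) - m) / d) * ((d : ℝ) - k)) :=
          mul_le_mul ih factor_le (by linarith) (by positivity)
      _ = _ := by ring

theorem multinomial_univ_succ {n : ℕ} (f : Fin (n + 1) → ℕ) :
    Nat.multinomial Finset.univ f
      = (∑ i, f i).choose (f 0) * Nat.multinomial Finset.univ (fun i : Fin n => f i.succ) := by
  have h := Nat.multinomial_spec Finset.univ f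
  have h' := Nat.multinomial_spec Finset.univ (fun i : Fin n => f i.succ)
  have hc := Nat.add_choose_mul_factorial_mul_factorial (f 0) (∑ i : Fin n, f i.succ)
  rw [Fin.prod_univ_succ, Fin.sum_univ_succ] at h
  rw [Fin.sum_univ_succ]
  refine Nat.eq_of_mul_eq_mul_left (Nat.mul_pos (f 0).factorial_pos
    (Finset.prod_pos fun i _ => (f (Fin.succ i)).factorial_pos)) (h.trans ?_)
  rw [← hc, ← h', ← Nat.choose_symm_add]
  ring

theorem sum_pairs_univ_succ {n : ℕ} (f : Fin (n + 1) → ℝ) :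
    (∑ i, ∑ j, if j < i then f i * f j else 0)
      = f 0 * ∑ i : Fin n, f i.succ
        + ∑ i : Fin n, ∑ j : Fin n, if j < i then f i.succ * f j.succ else 0 := by
  simp [Fin.sum_univ_succ, Finset.sum_add_distrib, Finset.mul_sum, mul_comm]

/-- A version of the multinomial bound for tuples whose sum may be smaller than `d`. -/
theorem multinomial_le_exp_mul_prod_choose_of_sum_le {n d : ℕ} (hd : 1 ≤ d)
    (f : Fin n → ℕ) (hsum : ∑ i, f i ≤ d) :
    (Nat.multinomial Finset.univ f : ℝ)
      ≤ Real.exp (-((∑ i, ∑ j, if j < i then (f i : ℝ) * (f j : ℝ) else 0)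
            + ((d : ℝ) - ∑ i, (f i : ℝ)) * ∑ i, (f i : ℝ)) / d)
        * ∏ i, (d.choose (f i) : ℝ) := by
  induction n with
  | zero => simp
  | succ n ih =>
    have htail := ih (fun i => f i.succ) (by rw [Fin.sum_univ_succ] at hsum; omega)
    have hhead := choose_le_exp_mul_choose hd hsum (f 0)
    rw [multinomial_univ_succ, Nat.cast_mul]
    refine (mul_le_mul hhead htail (by positivity) (by positivity)).trans (le_of_eq ?_)
    rw [sum_pairs_univ_succ (fun i => (f i : ℝ)), Fin.prod_univ_succ, mul_mul_mul_comm,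
      ← Real.exp_add]
    congr 2
    push_cast
    rw [Fin.sum_univ_succ]
    ring

/-- For `d ≥ 1` and nonnegative integers `d₁, …, dₙ` summing to `d`, the multinomial
coefficient satisfies
`d!/(d₁!⋯dₙ!) ≤ exp(-(∑_{j<i} dᵢ dⱼ)/d) · ∏ᵢ C(d, dᵢ)`. -/
theorem multinomial_le_exp_mul_prod_choose (n d : ℕ) (hd : 1 ≤ d)
    (f : Fin n → ℕ) (hsum : ∑ i, f i = d) :
    ((Nat.multinomial Finset.univ f : ℝ))
      ≤ Real.exp (-(∑ i : Fin n, ∑ j : Fin n,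
            if j < i then (f i : ℝ) * (f j : ℝ) else 0) / d)
        * ∏ i : Fin n, (d.choose (f i) : ℝ) := by
  have h := multinomial_le_exp_mul_prod_choose_of_sum_le hd f hsum.le
  have hcast : ∑ i, (f i : ℝ) = d := by exact_mod_cast hsum
  simpa only [hcast, sub_self, zero_mul, add_zero] using h
end
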